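/- Let q ≥ 1 be an integer and σ1, σ2, σ3 ∈ {1,−1} with σ1σ2σ3 = 1 and (−1)^q = σ1σ2 (equivalently, q and the quantity (1−σ1σ2)/2 have the same parity). Then the quadratic Euler S̃-sum S̃_{1,1,q}^{σ1,σ2,σ3} lies in the subalgebra of ℝ generated over ℚ by the set {π, G} ∪ {ζ(2k+1) : k ≥ 1} ∪ {β(2k) : k ≥ 2}. -/

import Mathlib

open scoped BigOperators

/-- Alternating odd harmonic number `h_n^{(p)}(σ) = ∑_{k=1}^n σ^{k-1}/(k-1/2)^p`. -/
noncomputable def oddH (n p : ℕ) (σ : ℝ) : ℝ :=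
  ∑ k ∈ Finset.range n, σ ^ k / ((k : ℝ) + 1 / 2) ^ p

/-- Quadratic Euler S̃-sum
`S̃_{p1,p2,q}^{σ1,σ2,σ} = ∑_{n≥1} σ^{n-1} h_n^{(p1)}(σ1) h_n^{(p2)}(σ2)/n^q`. -/
noncomputable def SSum2 (p1 p2 q : ℕ) (σ1 σ2 σ : ℝ) : ℝ :=
  ∑' n : ℕ, σ ^ n * oddH (n + 1) p1 σ1 * oddH (n + 1) p2 σ2 / ((n : ℝ) + 1) ^ q

/-- The Riemann zeta value `ζ(s) = ∑_{n≥1} 1/n^s`. -/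
noncomputable def zetaVal (s : ℕ) : ℝ := ∑' n : ℕ, 1 / ((n : ℝ) + 1) ^ s

/-- The Dirichlet beta value `β(s) = ∑_{n≥1} (-1)^{n-1}/(2n-1)^s`. -/
noncomputable def betaVal (s : ℕ) : ℝ := ∑' n : ℕ, (-1 : ℝ) ^ n / (2 * (n : ℝ) + 1) ^ s

noncomputable def hf (a : ℕ) : ℝ := (a : ℝ) + 1 / 2
noncomputable def nn (n : ℕ) : ℝ := (n : ℝ) + 1
noncomputable def KK (j : ℤ) : ℝ := 1 / |(j : ℝ) + 1 / 2| ^ (5 / 4 : ℝ)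

lemma hf_pos (a : ℕ) : 0 < hf a := by unfold hf; positivity
lemma nn_pos (n : ℕ) : 0 < nn n := by unfold nn; positivity
lemma one_le_nn (n : ℕ) : 1 ≤ nn n := by unfold nn; linarith [Nat.cast_nonneg (α := ℝ) n]

lemma half_ne (z : ℤ) : (z : ℝ) + 1 / 2 ≠ 0 := by
  intro h
  have : ((2 * z + 1 : ℤ) : ℝ) = 0 := by push_cast; linarith
  have h2 : 2 * z + 1 = 0 := by exact_mod_cast this
  omega

lemma hf_sub_ne (a n : ℕ) : hf a - nn n ≠ 0 := by
  have := half_ne ((a : ℤ) - n - 1)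
  unfold hf nn
  push_cast at this
  intro h; apply this; linarith

lemma sq_sub_ne (a n : ℕ) : hf a ^ 2 - nn n ^ 2 ≠ 0 := by
  have h1 := hf_sub_ne a n
  have h2 : hf a + nn n ≠ 0 := by linarith [hf_pos a, nn_pos n] |> fun (h : 0 < hf a + nn n) => h.ne'
  rw [sq_sub_sq]
  exact mul_ne_zero h2 h1

lemma hf_inj {a b : ℕ} (h : a ≠ b) : hf b ^ 2 - hf a ^ 2 ≠ 0 := by
  rw [sq_sub_sq]
  have h1 : hf b + hf a ≠ 0 := by have := hf_pos a; have := hf_pos b; positivity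
  refine mul_ne_zero h1 ?_
  unfold hf
  intro h'
  apply h
  have : (a : ℝ) = b := by linarith
  exact_mod_cast this

lemma KK_nonneg (j : ℤ) : 0 ≤ KK j := by unfold KK; positivity
lemma KK_summable : Summable KK := (Real.summable_one_div_int_add_rpow _ _).2 (by norm_num)

lemma KK_shift (m : ℤ) : Summable (fun a : ℕ => KK (a + m)) ∧ ∑' a : ℕ, KK (a + m) ≤ ∑' j, KK j := by
  have hi : Function.Injective (fun a : ℕ => (a : ℤ) + m) := by intro a b h; simpa using h
  exact ⟨KK_summable.comp_injective hi, tsum_comp_le_tsum_of_inj KK_summable KK_nonneg hi⟩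

lemma bnd {s N D : ℝ} (hN : 0 < N) (hD : 0 < D) (h1 : N ≤ s) (h2 : D ≤ s) :
    1 / (D * s) ≤ N ^ (-(3 / 4) : ℝ) * (1 / D ^ (5 / 4 : ℝ)) := by
  have hs : 0 < s := by linarith
  have e1 : N ^ (3 / 4 : ℝ) * D ^ (1 / 4 : ℝ) ≤ s := by
    calc N ^ (3 / 4 : ℝ) * D ^ (1 / 4 : ℝ) ≤ s ^ (3 / 4 : ℝ) * s ^ (1 / 4 : ℝ) := by gcongr
      _ = s := by rw [← Real.rpow_add hs]; norm_num
  have e2 : D ^ (5 / 4 : ℝ) = D * D ^ (1 / 4 : ℝ) := by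
    rw [← Real.rpow_one_add' hD.le (by norm_num)]; norm_num
  rw [Real.rpow_neg hN.le, e2, ← one_div, one_div_mul_one_div]
  apply one_div_le_one_div_of_le
  · positivity
  · calc _ = D * (N ^ (3 / 4 : ℝ) * D ^ (1 / 4 : ℝ)) := by ring
      _ ≤ _ := by gcongr

lemma bnd1 (a n : ℕ) : |1 / (hf a ^ 2 - nn n ^ 2)| ≤ nn n ^ (-(3 / 4) : ℝ) * KK (a + (-n - 1)) := by
  have h1 := hf_pos a
  have h2 := nn_pos n
  have h3 : 0 < |hf a - nn n| := abs_pos.2 (hf_sub_ne a n)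
  have := bnd (s := hf a + nn n) h2 h3 (by linarith) (by rw [abs_le]; constructor <;> linarith)
  have e : |1 / (hf a ^ 2 - nn n ^ 2)| = 1 / (|hf a - nn n| * (hf a + nn n)) := by
    rw [sq_sub_sq, abs_div, abs_mul, abs_of_pos (add_pos h1 h2), abs_one, mul_comm]
  have e2 : KK (a + (-n - 1)) = 1 / |hf a - nn n| ^ (5 / 4 : ℝ) := by
    unfold KK hf nn; push_cast; congr 3; ring
  rw [e, e2]; exact this

lemma bnd2 (a n : ℕ) : |nn n * (1 / hf a) / (hf a ^ 2 - nn n ^ 2)| ≤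
    nn n ^ (-(3 / 4) : ℝ) * (KK (a + (-n - 1)) + KK (a + 0)) := by
  have h1 := hf_pos a
  have h2 := nn_pos n
  have h3 : 0 < |hf a - nn n| := abs_pos.2 (hf_sub_ne a n)
  have hb := bnd1 a n
  have := bnd (s := hf a + nn n) h2 h1 (by linarith) (by linarith)
  have e2 : KK (a + 0) = 1 / hf a ^ (5 / 4 : ℝ) := by
    unfold KK; push_cast; rw [add_zero, abs_of_pos (by positivity)]; rfl
  rw [mul_add, e2]
  refine le_trans ?_ (add_le_add hb this)
  rw [sq_sub_sq, abs_div, abs_div, abs_mul, abs_mul, abs_of_pos (add_pos h1 h2), abs_one, abs_of_pos h2,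
    abs_of_pos (one_div_pos.2 h1)]
  have key : nn n ≤ hf a + |hf a - nn n| := by
    have := neg_abs_le (hf a - nn n); linarith
  have h4 : 0 < hf a + nn n := by linarith
  have : 1 / ((hf a + nn n) * |hf a - nn n|) + 1 / (hf a * (hf a + nn n)) - nn n * (1 / hf a) / ((hf a + nn n) * |hf a - nn n|)
    = (hf a + |hf a - nn n| - nn n) / (hf a * (hf a + nn n) * |hf a - nn n|) := by
    field_simp
  have h5 : 0 ≤ (hf a + |hf a - nn n| - nn n) / (hf a * (hf a + nn n) * |hf a - nn n|) := by
    apply div_nonneg; linarith; positivity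
  linarith

def Good (x : ℕ → ℕ → ℝ) : Prop := ∃ C : ℝ, 0 ≤ C ∧ ∀ n, Summable (fun a => |x n a|) ∧
  ∑' a, |x n a| ≤ C * nn n ^ (-(3 / 4) : ℝ)

lemma good_y (e : ℕ → ℝ) (he : ∀ a, |e a| = 1) : Good (fun n a => e a / (hf a ^ 2 - nn n ^ 2)) := by
  refine ⟨∑' j, KK j, tsum_nonneg KK_nonneg, fun n => ?_⟩
  have hb : ∀ a, |e a / (hf a ^ 2 - nn n ^ 2)| ≤ nn n ^ (-(3 / 4) : ℝ) * KK (a + (-n - 1)) := by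
    intro a
    have := bnd1 a n
    rw [abs_div] at this ⊢
    rwa [he, ← abs_one]
  have hs := (KK_shift (-n - 1)).1.mul_left (nn n ^ (-(3 / 4) : ℝ))
  have hs' := Summable.of_nonneg_of_le (fun a => abs_nonneg _) hb hs
  refine ⟨hs', (hs'.tsum_le_tsum hb hs).trans ?_⟩
  rw [tsum_mul_left, mul_comm]
  have := (KK_shift (-n - 1)).2
  have h := nn_pos n
  gcongr

lemma good_x : Good (fun n a => nn n * (1 / hf a) / (hf a ^ 2 - nn n ^ 2)) := by
  refine ⟨∑' j, KK j + ∑' j, KK j, add_nonneg (tsum_nonneg KK_nonneg) (tsum_nonneg KK_nonneg), fun n => ?_⟩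
  have hb := fun a => bnd2 a n
  have hs := ((KK_shift (-n - 1)).1.add (KK_shift 0).1).mul_left (nn n ^ (-(3 / 4) : ℝ))
  have hs' := Summable.of_nonneg_of_le (fun a => abs_nonneg _) hb hs
  refine ⟨hs', (hs'.tsum_le_tsum hb hs).trans ?_⟩
  rw [tsum_mul_left, mul_comm, (KK_shift (-n - 1)).1.tsum_add (KK_shift 0).1]
  have := (KK_shift (-n - 1)).2
  have := (KK_shift 0).2
  have h := nn_pos n
  gcongr

lemma hasSum_tele (G : ℕ → ℝ) (hG : Filter.Tendsto G Filter.atTop (nhds 0))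
    (f : ℕ → ℝ) (hf : Summable f) (h : ∀ a, f a = G a - G (a + 1)) : HasSum f (G 0) := by
  rw [hf.hasSum_iff_tendsto_nat]
  simp only [h, Finset.sum_range_sub']
  simpa using hG.const_sub (G 0)

lemma tend_aux (z : ℝ) : Filter.Tendsto (fun a : ℕ => 1 / (hf a + z)) Filter.atTop (nhds 0) := by
  simp only [one_div]
  apply Filter.Tendsto.inv_tendsto_atTop
  unfold hf
  apply Filter.tendsto_atTop_add_const_right
  apply Filter.tendsto_atTop_add_const_right
  exact tendsto_natCast_atTop_atTop

lemma hf_succ (a : ℕ) : hf (a + 1) = hf a + 1 := by unfold hf; push_cast; ring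
lemma nn_succ (a : ℕ) : nn (a + 1) = nn a + 1 := by unfold nn; push_cast; ring

/-- index version with N : ℕ (N may be zero) -/
lemma hf_sub_nat (a N : ℕ) : hf a - N ≠ 0 := by
  rcases N with _ | n
  · simpa using (hf_pos a).ne'
  · simpa [nn] using hf_sub_ne a n

lemma sumx (N : ℕ) : HasSum (fun a => 1 / hf a - 1 / 2 * (1 / (hf a - N) + 1 / (hf a + N))) (oddH N 1 1) := by
  have hsum : ∀ N : ℕ, Summable (fun a => 1 / hf a - 1 / 2 * (1 / (hf a - N) + 1 / (hf a + N))) := by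
    intro N
    rcases N with _ | n
    · refine summable_zero.congr ?_; intro a; simp; ring
    · obtain ⟨C, _, hC⟩ := good_x
      refine ((hC n).1.of_abs.mul_left (-nn n)).congr ?_
      intro a
      have h1 := hf_sub_ne a n
      have h2 := hf_pos a
      have h3 : 0 < hf a + nn n := add_pos h2 (nn_pos n)
      have e : ((n + 1 : ℕ) : ℝ) = nn n := by simp [nn]
      beta_reduce
      rw [e, sq_sub_sq]
      field_simp
      ring
  induction N with
  | zero => 
    have e : oddH 0 1 1 = 0 := by simp [oddH]
    rw [e]
    refine hasSum_zero.congr_fun ?_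
    intro a; simp; ring
  | succ N ih =>
    have e : oddH (N + 1) 1 1 = oddH N 1 1 + 1 / ((N : ℝ) + 1 / 2) := by
      simp [oddH, Finset.sum_range_succ]
    have ht := hasSum_tele (fun a => 1 / 2 * (1 / (hf a + N) - 1 / (hf a - (N + 1 : ℕ)))) (by
      have := ((tend_aux N).sub (tend_aux (-(N + 1 : ℕ)))).const_mul (1 / 2)
      simpa [sub_eq_add_neg] using this) _ ((hsum (N + 1)).sub (hsum N)) (by
      intro a
      have h0 := hf_pos a
      have h1 := hf_sub_nat a (N + 1)
      have h2 := hf_sub_nat a N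
      rw [hf_succ]
      have h3 : hf a + 1 - ((N + 1 : ℕ) : ℝ) = hf a - N := by push_cast; ring
      have h4 : hf a + 1 + N = hf a + (N + 1 : ℕ) := by push_cast; ring
      rw [h3, h4]
      ring)
    have := ht.add ih
    simp only [sub_add_cancel] at this
    convert this using 1
    rw [e]
    have h0 : hf 0 = 1 / 2 := by simp [hf]
    rw [h0]
    have : (1 / 2 - ((N + 1 : ℕ) : ℝ)) = - (N + 1 / 2) := by push_cast; ring
    rw [this]
    have : (N : ℝ) + 1 / 2 ≠ 0 := by positivity
    rw [add_comm (1 / 2 : ℝ) N]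
    field_simp
    ring

lemma sumy (N : ℕ) : HasSum (fun a => 1 / 2 * (-1) ^ a * (1 / (hf a - N) - 1 / (hf a + N))) ((-1) ^ N * oddH N 1 (-1)) := by
  have hsum : ∀ N : ℕ, Summable (fun a => 1 / 2 * (-1) ^ a * (1 / (hf a - N) - 1 / (hf a + N))) := by
    intro N
    rcases N with _ | n
    · refine summable_zero.congr ?_; intro a; simp
    · obtain ⟨C, _, hC⟩ := good_y (fun a => (-1) ^ a) (by simp)
      refine ((hC n).1.of_abs.mul_left (nn n)).congr ?_
      intro a
      have h1 := hf_sub_ne a n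
      have h2 := hf_pos a
      have h3 : 0 < hf a + nn n := add_pos h2 (nn_pos n)
      have e : ((n + 1 : ℕ) : ℝ) = nn n := by simp [nn]
      beta_reduce
      rw [e, sq_sub_sq]
      field_simp
      ring
  induction N with
  | zero => 
    have e : oddH 0 1 (-1) = 0 := by simp [oddH]
    rw [e]
    simp only [mul_zero]
    refine hasSum_zero.congr_fun ?_
    intro a; simp
  | succ N ih =>
    have e : oddH (N + 1) 1 (-1) = oddH N 1 (-1) + (-1) ^ N / ((N : ℝ) + 1 / 2) := by
      simp [oddH, Finset.sum_range_succ]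
    have ht := hasSum_tele (fun a => 1 / 2 * (-1) ^ a * (1 / (hf a - (N + 1 : ℕ)) - 1 / (hf a + N))) (by
      have := ((tend_aux (-(N + 1 : ℕ))).sub (tend_aux N)).const_mul (1 / 2)
      simp only [sub_zero, mul_zero, ← sub_eq_add_neg] at this
      rw [tendsto_zero_iff_abs_tendsto_zero] at this ⊢
      refine this.congr ?_
      intro a
      simp [Function.comp, abs_mul]) _ ((hsum (N + 1)).add (hsum N)) (by
      intro a
      have h0 := hf_pos a
      have h1 := hf_sub_nat a (N + 1)
      have h2 := hf_sub_nat a N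
      rw [hf_succ]
      have h3 : hf a + 1 - ((N + 1 : ℕ) : ℝ) = hf a - N := by push_cast; ring
      have h4 : hf a + 1 + N = hf a + (N + 1 : ℕ) := by push_cast; ring
      rw [h3, h4]
      ring)
    have := ht.sub ih
    simp only [add_sub_cancel_right] at this
    suffices hv : (-1 : ℝ) ^ (N + 1) * oddH (N + 1) 1 (-1) = 1 / 2 * (-1) ^ 0 *
        (1 / (hf 0 - (N + 1 : ℕ)) - 1 / (hf 0 + N)) - (-1) ^ N * oddH N 1 (-1) by
      rw [hv]; exact this
    rw [e]
    have h0 : hf 0 = 1 / 2 := by simp [hf]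
    rw [h0]
    have : (1 / 2 - ((N + 1 : ℕ) : ℝ)) = - (N + 1 / 2) := by push_cast; ring
    rw [this]
    have : (N : ℝ) + 1 / 2 ≠ 0 := by positivity
    rw [add_comm (1 / 2 : ℝ) N]
    have h1 : ((-1 : ℝ) ^ N) ^ 2 = 1 := by rw [← pow_mul, mul_comm, pow_mul]; simp
    rw [pow_succ]
    field_simp
    linear_combination (-2) * h1

lemma oddH_x (n : ℕ) : oddH (n + 1) 1 1 = -nn n * ∑' a, nn n * (1 / hf a) / (hf a ^ 2 - nn n ^ 2) := by
  rw [← (sumx (n + 1)).tsum_eq, ← tsum_mul_left]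
  congr 1; ext a
  have h1 := hf_sub_ne a n
  have h2 := hf_pos a
  have h3 : 0 < hf a + nn n := add_pos h2 (nn_pos n)
  have e : ((n + 1 : ℕ) : ℝ) = nn n := by simp [nn]
  rw [e, sq_sub_sq]
  field_simp
  ring

lemma oddH_y (n : ℕ) : oddH (n + 1) 1 (-1) = -(-1) ^ n * nn n * ∑' a, (-1) ^ a / (hf a ^ 2 - nn n ^ 2) := by
  have h := (sumy (n + 1)).tsum_eq
  have e2 : oddH (n + 1) 1 (-1) = - (-1) ^ n * ((-1) ^ (n + 1) * oddH (n + 1) 1 (-1)) := by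
    have h1 : ((-1 : ℝ) ^ n) * (-1) ^ n = 1 := by rw [← pow_add, ← two_mul, pow_mul]; simp
    rw [pow_succ]
    linear_combination (-oddH (n + 1) 1 (-1)) * h1
  rw [e2, ← h, mul_assoc, ← tsum_mul_left (a := nn n)]
  congr 2; ext a
  have h1 := hf_sub_ne a n
  have h2 := hf_pos a
  have h3 : 0 < hf a + nn n := add_pos h2 (nn_pos n)
  have e : ((n + 1 : ℕ) : ℝ) = nn n := by simp [nn]
  rw [e, sq_sub_sq]
  field_simp
  ring

lemma hasSum_R0 (a : ℕ) : HasSum (fun n => 1 / (hf a ^ 2 - nn n ^ 2)) (-1 / 2 / hf a ^ 2) := by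
  have hz : ((hf a : ℝ) : ℂ) ∈ Complex.integerComplement := by
    rintro ⟨z, hz⟩
    have h : (z : ℝ) = hf a := by exact_mod_cast hz
    apply half_ne (a - z)
    unfold hf at h
    push_cast
    linarith
  have h := cot_series_rep' hz
  have hc : Complex.cot (Real.pi * (hf a : ℂ)) = 0 := by
    unfold Complex.cot
    have : Complex.cos (Real.pi * (hf a : ℂ)) = 0 := by
      rw [Complex.cos_eq_zero_iff]
      refine ⟨a, ?_⟩
      unfold hf; push_cast; ring
    rw [this, zero_div]
  rw [hc, mul_zero, zero_sub] at h
  have hs : Summable (fun n => 1 / (hf a ^ 2 - nn n ^ 2)) := by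
    have h0 : Summable (fun n : ℕ => 1 / |(n : ℝ) + 1| ^ (2 : ℝ)) :=
      (Real.summable_one_div_nat_add_rpow 1 2).2 (by norm_num)
    have h0 : Summable (fun n : ℕ => 2 * (1 / nn n ^ 2)) := by
      refine (h0.mul_left 2).congr ?_
      intro n
      have := nn_pos n
      unfold nn at this ⊢
      rw [abs_of_pos this, Real.rpow_two]
    apply h0.of_norm_bounded_eventually_nat
    filter_upwards [Filter.eventually_ge_atTop (2 * a + 2)] with n hn
    have hn' : 2 * hf a ≤ nn n := by
      have : ((2 * a + 2 : ℕ) : ℝ) ≤ n := by exact_mod_cast hn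
      unfold hf nn; push_cast at this; linarith
    have h1 := hf_pos a
    have h2 := nn_pos n
    have h3 : nn n ^ 2 / 2 ≤ nn n ^ 2 - hf a ^ 2 := by nlinarith
    have h4 : 0 < nn n ^ 2 := by positivity
    rw [Real.norm_eq_abs, abs_div, abs_one, abs_sub_comm, abs_of_pos (by linarith)]
    calc _ ≤ 1 / (nn n ^ 2 / 2) := one_div_le_one_div_of_le (by positivity) h3
      _ = _ := by field_simp
  rw [hs.hasSum_iff]
  have e : ∀ n : ℕ, (1 / ((hf a : ℂ) - (n + 1)) + 1 / ((hf a : ℂ) + (n + 1)))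
      = ((2 * hf a * (1 / (hf a ^ 2 - nn n ^ 2)) : ℝ) : ℂ) := by
    intro n
    have h1 : 1 / (hf a - nn n) + 1 / (hf a + nn n) = 2 * hf a * (1 / (hf a ^ 2 - nn n ^ 2)) := by
      have h1 := hf_sub_ne a n
      have h2 := hf_pos a
      have h3 : 0 < hf a + nn n := add_pos h2 (nn_pos n)
      rw [sq_sub_sq]
      field_simp
      ring
    rw [← h1]; unfold nn; push_cast; rfl
  simp only [e] at h
  rw [← Complex.ofReal_tsum, tsum_mul_left] at h
  have h' : -(1 / hf a) = 2 * hf a * ∑' n, 1 / (hf a ^ 2 - nn n ^ 2) := by exact_mod_cast h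
  have h1 := hf_pos a
  field_simp
  field_simp at h'
  linarith

lemma hasSum_zeta_nn (k : ℕ) (hk : k ≠ 0) : HasSum (fun n => 1 / nn n ^ (2 * k)) (zetaVal (2 * k)) := by
  have h := (hasSum_zeta_nat hk).summable
  have h2 := (summable_nat_add_iff 1).2 h
  have : (fun n => 1 / nn n ^ (2 * k)) = fun n : ℕ => 1 / ((n + 1 : ℕ) : ℝ) ^ (2 * k) := by
    ext n; simp [nn]
  unfold zetaVal
  have h3 : Summable (fun n => 1 / nn n ^ (2 * k)) := by rw [this]; exact h2
  exact h3.hasSum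

noncomputable def zz (j : ℕ) : ℝ := if j = 0 then -1 / 2 else zetaVal (2 * j)

noncomputable def RR (k : ℕ) (b : ℕ) : ℝ := ∑ j ∈ Finset.range (k + 1), zz (k - j) / hf b ^ (2 * (j + 1))

lemma RR_succ (k b : ℕ) : RR (k + 1) b = (1 / hf b ^ 2) * (zz (k + 1) + RR k b) := by
  unfold RR
  rw [Finset.sum_range_succ', mul_add (1 / hf b ^ 2), Finset.mul_sum, add_comm]
  have := hf_pos b
  congr 1
  · simp; field_simp
  · refine Finset.sum_congr rfl fun j _ => ?_
    rw [Nat.add_sub_add_right]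
    field_simp
    ring

lemma hasSum_R (k b : ℕ) : HasSum (fun n => 1 / nn n ^ (2 * k) / (hf b ^ 2 - nn n ^ 2)) (RR k b) := by
  induction k with
  | zero => simpa [RR, zz] using hasSum_R0 b
  | succ k ih =>
    have := ((hasSum_zeta_nn (k + 1) (by simp)).add ih).mul_left (1 / hf b ^ 2)
    rw [RR_succ]
    have hz : zz (k + 1) = zetaVal (2 * (k + 1)) := by simp [zz]
    rw [hz]
    refine this.congr_fun ?_
    intro n
    have h1 := sq_sub_ne b n
    have h2 := hf_pos b
    have h3 := nn_pos n
    field_simp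
    ring

lemma hasSum_half_sq : HasSum (fun a => 1 / hf a ^ 2) (Real.pi ^ 2 / 2) := by
  have h := hasSum_zeta_two
  have he : HasSum (fun k : ℕ => 1 / ((2 * k : ℕ) : ℝ) ^ 2) (Real.pi ^ 2 / 24) := by
    have := h.mul_left (1 / 4)
    rw [show Real.pi ^ 2 / 24 = 1 / 4 * (Real.pi ^ 2 / 6) by ring]
    refine this.congr_fun ?_
    intro n; push_cast; rw [mul_pow, one_div_mul_one_div]; norm_num
  have hs : Summable (fun k : ℕ => 1 / ((2 * k + 1 : ℕ) : ℝ) ^ 2) := 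
    h.summable.comp_injective (i := fun k : ℕ => 2 * k + 1) (by intro a b; simp)
  have ht := (he.even_add_odd (f := fun n : ℕ => 1 / (n : ℝ) ^ 2) hs.hasSum).unique h
  have hv : ∑' k : ℕ, 1 / ((2 * k + 1 : ℕ) : ℝ) ^ 2 = Real.pi ^ 2 / 8 := by linarith
  have := hs.hasSum.mul_left 4
  rw [hv] at this
  rw [show Real.pi ^ 2 / 2 = 4 * (Real.pi ^ 2 / 8) by ring]
  refine this.congr_fun ?_
  intro a
  unfold hf
  have : (2 * (a : ℝ) + 1) ≠ 0 := by positivity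
  have h2 : (a : ℝ) + 1 / 2 ≠ 0 := by positivity
  push_cast
  field_simp
  ring

lemma hasSum_int_aux {f : ℤ → ℝ} {s : ℝ} (h2 : HasSum f s) :
    HasSum (fun n : ℕ => f ((n : ℤ) + 1) + f (-((n : ℤ) + 1))) (s - f 0) := by
  have s1 : Summable (fun n : ℕ => f ((n : ℤ) + 1)) :=
    h2.summable.comp_injective (i := fun n : ℕ => ((n : ℤ) + 1)) (by intro a b; simp)
  have s2 : Summable (fun n : ℕ => f (-((n : ℤ) + 1))) :=
    h2.summable.comp_injective (i := fun n : ℕ => -((n : ℤ) + 1)) (by intro a b; simp)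
  have h3 := (s1.hasSum.of_add_one_of_neg_add_one s2.hasSum).unique h2
  have h4 := s1.hasSum.add s2.hasSum
  rw [← h3]
  convert h4 using 1
  ring

lemma hasSum_int_sq (a : ℕ) : HasSum (fun n => 1 / (nn n - hf a) ^ 2 + 1 / (nn n + hf a) ^ 2)
    (Real.pi ^ 2 - 1 / hf a ^ 2) := by
  have h : HasSum (fun j : ℤ => 1 / ((j : ℝ) + 1 / 2) ^ 2) (Real.pi ^ 2 / 2 + Real.pi ^ 2 / 2) := by
    apply HasSum.of_nat_of_neg_add_one
    · exact hasSum_half_sq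
    · refine hasSum_half_sq.congr_fun ?_
      intro n
      unfold hf
      push_cast
      rw [← neg_sq]
      congr 2; ring
  rw [add_halves] at h
  have h2 : HasSum (fun j : ℤ => 1 / ((j : ℝ) + hf a) ^ 2) (Real.pi ^ 2) := by
    have := (Equiv.addRight (a : ℤ)).hasSum_iff.2 h
    refine this.congr_fun ?_
    intro j
    simp only [Function.comp, Equiv.coe_addRight, hf]
    push_cast
    rw [add_assoc]
  have h4 := hasSum_int_aux h2
  have e : Real.pi ^ 2 - 1 / hf a ^ 2 = Real.pi ^ 2 - 1 / (((0 : ℤ) : ℝ) + hf a) ^ 2 := by simp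
  rw [e]
  refine h4.congr_fun ?_
  intro n
  simp only [nn]
  push_cast
  rw [add_comm]
  congr 2
  ring

lemma hasSum_T0 (a b : ℕ) : HasSum (fun n => nn n ^ 2 / ((hf a ^ 2 - nn n ^ 2) * (hf b ^ 2 - nn n ^ 2)))
    (if a = b then Real.pi ^ 2 / 4 else 0) := by
  by_cases h : a = b
  · subst h
    rw [if_pos rfl]
    have := ((hasSum_int_sq a).sub ((hasSum_R0 a).mul_left 2)).mul_left (1 / 4)
    have h0 := hf_pos a
    rw [show Real.pi ^ 2 / 4 = 1 / 4 * (Real.pi ^ 2 - 1 / hf a ^ 2 - 2 * (-1 / 2 / hf a ^ 2)) by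
      field_simp; ring]
    refine this.congr_fun ?_
    intro n
    have h1 := hf_sub_ne a n
    have h2 : nn n - hf a ≠ 0 := by intro h; apply h1; linarith
    have h3 : 0 < hf a + nn n := add_pos h0 (nn_pos n)
    have h4 : 0 < nn n + hf a := by linarith
    have e1 : hf a ^ 2 - nn n ^ 2 = -((nn n - hf a) * (nn n + hf a)) := by ring
    rw [e1]
    field_simp
    ring
  · rw [if_neg h]
    have h1 := hf_inj h
    have := (((hasSum_R0 a).mul_left (hf a ^ 2)).sub ((hasSum_R0 b).mul_left (hf b ^ 2))).mul_left (1 / (hf b ^ 2 - hf a ^ 2))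
    have ha := hf_pos a
    have hb := hf_pos b
    rw [show (0 : ℝ) = (1 / (hf b ^ 2 - hf a ^ 2)) * (hf a ^ 2 * (-1 / 2 / hf a ^ 2) - hf b ^ 2 * (-1 / 2 / hf b ^ 2)) by
      field_simp; ring]
    refine this.congr_fun ?_
    intro n
    have h2 := sq_sub_ne a n
    have h3 := sq_sub_ne b n
    field_simp
    ring

noncomputable def TT (k a b : ℕ) : ℝ := 1 / hf a ^ (2 * k) * (if a = b then Real.pi ^ 2 / 4 else 0) +
  ∑ i ∈ Finset.range k, 1 / hf a ^ (2 * (i + 1)) * RR (k - 1 - i) b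

lemma TT_succ (k a b : ℕ) : TT (k + 1) a b = 1 / hf a ^ 2 * (RR k b + TT k a b) := by
  unfold TT
  have := hf_pos a
  rw [Finset.sum_range_succ']
  rw [mul_add (1 / hf a ^ 2), mul_add (1 / hf a ^ 2), Finset.mul_sum]
  have : ∀ i ∈ Finset.range k, 1 / hf a ^ (2 * (i + 1 + 1)) * RR (k + 1 - 1 - (i + 1)) b
    = 1 / hf a ^ 2 * (1 / hf a ^ (2 * (i + 1)) * RR (k - 1 - i) b) := by
    intro i _
    rw [show k + 1 - 1 - (i + 1) = k - 1 - i by omega]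
    rw [← mul_assoc, one_div_mul_one_div, ← pow_add]
    congr 3
    ring
  rw [Finset.sum_congr rfl this]
  simp only [Nat.add_sub_cancel, Nat.sub_zero, zero_add, mul_one]
  have e : 1 / hf a ^ (2 * (k + 1)) = 1 / hf a ^ 2 * (1 / hf a ^ (2 * k)) := by
    rw [one_div_mul_one_div, ← pow_add]
    congr 2
    ring
  rw [e]
  ring

lemma hasSum_T (k a b : ℕ) : HasSum (fun n => nn n ^ 2 / nn n ^ (2 * k) /
    ((hf a ^ 2 - nn n ^ 2) * (hf b ^ 2 - nn n ^ 2))) (TT k a b) := by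
  induction k with
  | zero => simpa [TT] using hasSum_T0 a b
  | succ k ih =>
    rw [TT_succ]
    refine (((hasSum_R k b).add ih).mul_left (1 / hf a ^ 2)).congr_fun ?_
    intro n
    have h2 := sq_sub_ne a n
    have h3 := sq_sub_ne b n
    have h4 := hf_pos a
    have h5 := nn_pos n
    field_simp
    ring

noncomputable def AA : Subalgebra ℚ ℝ := Algebra.adjoin ℚ
      ({Real.pi, betaVal 2}
        ∪ {x : ℝ | ∃ k : ℕ, 1 ≤ k ∧ x = zetaVal (2 * k + 1)}
        ∪ {x : ℝ | ∃ k : ℕ, 2 ≤ k ∧ x = betaVal (2 * k)})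

lemma pi_mem : Real.pi ∈ AA := Algebra.subset_adjoin (by simp)
lemma rat_mem (r : ℚ) : (r : ℝ) ∈ AA := by
  have := AA.algebraMap_mem r
  simpa using this
lemma zeta_odd_mem (k : ℕ) (hk : 1 ≤ k) : zetaVal (2 * k + 1) ∈ AA :=
  Algebra.subset_adjoin (Or.inl (Or.inr ⟨k, hk, rfl⟩))
lemma beta_even_mem (k : ℕ) (hk : 1 ≤ k) : betaVal (2 * k) ∈ AA := by
  rcases hk.eq_or_lt with rfl | h
  · exact Algebra.subset_adjoin (by simp)
  · exact Algebra.subset_adjoin (Or.inr ⟨k, h, rfl⟩)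

lemma zeta_even_mem (k : ℕ) (hk : k ≠ 0) : zetaVal (2 * k) ∈ AA := by
  have h := hasSum_zeta_nat hk
  have h2 := (hasSum_nat_add_iff' 1).2 h
  have e : zetaVal (2 * k) = ((-1) ^ (k + 1) * 2 ^ (2 * k - 1) * Real.pi ^ (2 * k) * (bernoulli (2 * k) : ℝ) / (2 * k).factorial) := by
    have h3 := h2.unique (f := fun n : ℕ => 1 / ((n + 1 : ℕ) : ℝ) ^ (2 * k)) (by
      have := hasSum_zeta_nn k hk
      simpa [nn] using this)
    rw [← h3]
    simp [hk]
  rw [e]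
  have : ((-1) ^ (k + 1) * 2 ^ (2 * k - 1) * Real.pi ^ (2 * k) * (bernoulli (2 * k) : ℝ) / (2 * k).factorial)
    = (((-1) ^ (k + 1) * 2 ^ (2 * k - 1) * bernoulli (2 * k) / (2 * k).factorial : ℚ) : ℝ) * Real.pi ^ (2 * k) := by
    push_cast; ring
  rw [this]
  exact mul_mem (rat_mem _) (pow_mem pi_mem _)

lemma zz_mem (j : ℕ) : zz j ∈ AA := by
  unfold zz
  split_ifs with h
  · have := rat_mem (-1 / 2); push_cast at this; exact this
  · exact zeta_even_mem j h

def InA {ι : Type} (f : ι → ℝ) : Prop := ∃ s ∈ AA, HasSum f s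

lemma InA.summable {ι : Type} {f : ι → ℝ} (h : InA f) : Summable f := by
  obtain ⟨s, _, h⟩ := h; exact h.summable
lemma InA.mem {ι : Type} {f : ι → ℝ} (h : InA f) : ∑' i, f i ∈ AA := by
  obtain ⟨s, hs, h⟩ := h; rw [h.tsum_eq]; exact hs
lemma InA.add {ι : Type} {f g : ι → ℝ} (h : InA f) (h' : InA g) : InA (fun i => f i + g i) := by
  obtain ⟨s, hs, h⟩ := h
  obtain ⟨t, ht, h'⟩ := h'
  exact ⟨s + t, add_mem hs ht, h.add h'⟩
lemma InA.cmul {ι : Type} {f : ι → ℝ} (h : InA f) {c : ℝ} (hc : c ∈ AA) : InA (fun i => c * f i) := by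
  obtain ⟨s, hs, h⟩ := h
  exact ⟨c * s, mul_mem hc hs, h.mul_left c⟩
lemma InA.sum {ι κ : Type} (t : Finset κ) {f : κ → ι → ℝ} (h : ∀ k ∈ t, InA (f k)) : InA (fun i => ∑ k ∈ t, f k i) := by
  refine ⟨∑ k ∈ t, ∑' i, f k i, sum_mem fun k hk => (h k hk).mem, hasSum_sum fun k hk => (h k hk).summable.hasSum⟩
lemma InA.congr {ι : Type} {f g : ι → ℝ} (h : InA f) (e : ∀ i, g i = f i) : InA g := by
  rwa [show g = f from funext e]
lemma InA.mul {f g : ℕ → ℝ} (h : InA f) (h' : InA g) : InA (fun p : ℕ × ℕ => f p.1 * g p.2) := by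
  refine ⟨(∑' i, f i) * ∑' i, g i, mul_mem h.mem h'.mem, ?_⟩
  have a := h.summable.norm
  have b := h'.summable.norm
  rw [tsum_mul_tsum_of_summable_norm a b]
  exact (Summable.mul_norm a b).of_norm.hasSum
lemma InA.diag {g : ℕ → ℝ} (h : InA g) : InA (fun p : ℕ × ℕ => if p.1 = p.2 then g p.1 else 0) := by
  obtain ⟨s, hs, h⟩ := h
  refine ⟨s, hs, ?_⟩
  have hi : Function.Injective (fun a : ℕ => (a, a)) := by intro a b h; simpa using h
  rw [← hi.hasSum_iff]
  · simpa [Function.comp_def] using h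
  · rintro ⟨a, b⟩ hx
    rw [if_neg]
    rintro h
    apply hx
    exact ⟨a, by simpa using h⟩

lemma summable_nn (s : ℕ) (hs : 2 ≤ s) : Summable (fun n => 1 / nn n ^ s) := by
  have h := Real.summable_one_div_nat_pow.2 (show 1 < s by omega)
  have h2 := (summable_nat_add_iff 1).2 h
  refine h2.congr ?_
  intro n; simp [nn]

lemma hasSum_hf (s : ℕ) (hs : 2 ≤ s) : HasSum (fun a => 1 / hf a ^ s) (((2 ^ s - 1 : ℚ) : ℝ) * zetaVal s) := by
  have hz : HasSum (fun n => 1 / nn n ^ s) (zetaVal s) := (summable_nn s hs).hasSum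
  have s1 : Summable (fun k => 1 / nn (2 * k) ^ s) :=
    hz.summable.comp_injective (i := fun k : ℕ => 2 * k) (by intro a b; simp)
  have ho : HasSum (fun k => 1 / nn (2 * k + 1) ^ s) (1 / 2 ^ s * zetaVal s) := by
    refine (hz.mul_left (1 / 2 ^ s)).congr_fun ?_
    intro n
    rw [one_div_mul_one_div, ← mul_pow]
    unfold nn; push_cast; congr 2; ring
  have ht := (s1.hasSum.even_add_odd (f := fun n => 1 / nn n ^ s) ho).unique hz
  have := s1.hasSum.mul_left (2 ^ s)
  rw [show ((2 ^ s - 1 : ℚ) : ℝ) * zetaVal s = 2 ^ s * ∑' k, 1 / nn (2 * k) ^ s by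
    rw [eq_sub_of_add_eq ht]; push_cast; field_simp]
  refine this.congr_fun ?_
  intro a
  have : nn (2 * a) = 2 * hf a := by unfold nn hf; push_cast; ring
  rw [this, mul_pow]
  have := hf_pos a
  field_simp

lemma hf_InA_even (k : ℕ) (hk : 1 ≤ k) : InA (fun a => 1 / hf a ^ (2 * k)) :=
  ⟨_, mul_mem (rat_mem _) (zeta_even_mem k (by omega)), hasSum_hf (2 * k) (by omega)⟩
lemma hf_InA_odd (k : ℕ) (hk : 1 ≤ k) : InA (fun a => 1 / hf a ^ (2 * k + 1)) :=
  ⟨_, mul_mem (rat_mem _) (zeta_odd_mem k hk), hasSum_hf (2 * k + 1) (by omega)⟩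

lemma hasSum_eps (s : ℕ) (hs : 2 ≤ s) : HasSum (fun a => (-1) ^ a / hf a ^ s) (((2 ^ s : ℚ) : ℝ) * betaVal s) := by
  have h1 : Summable (fun a => (-1) ^ a / hf a ^ s) := by
    apply Summable.of_norm
    refine (hasSum_hf s hs).summable.congr ?_
    intro a
    have := hf_pos a
    rw [norm_div, norm_pow, norm_neg, norm_one, one_pow, Real.norm_of_nonneg (by positivity)]
  rw [h1.hasSum_iff]
  unfold betaVal
  rw [← tsum_mul_left]
  congr 1; ext a
  have : 2 * (a : ℝ) + 1 = 2 * hf a := by unfold hf; ring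
  rw [this, mul_pow]
  have := hf_pos a
  push_cast
  field_simp

lemma eps_InA_even (k : ℕ) (hk : 1 ≤ k) : InA (fun a => (-1) ^ a / hf a ^ (2 * k)) :=
  ⟨_, mul_mem (rat_mem _) (beta_even_mem k hk), hasSum_eps (2 * k) (by omega)⟩

lemma beta_odd_mem (k : ℕ) (hk : 1 ≤ k) : betaVal (2 * k + 1) ∈ AA := by
  have h := hasSum_one_div_nat_pow_mul_sin (k := k) (by omega) (x := 1 / 4) (by constructor <;> norm_num)
  have e1 : (Polynomial.map (algebraMap ℚ ℝ) (Polynomial.bernoulli (2 * k + 1))).eval (1 / 4 : ℝ)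
     = (((Polynomial.bernoulli (2 * k + 1)).eval (1 / 4 : ℚ) : ℚ) : ℝ) := by
    have : (1 / 4 : ℝ) = (algebraMap ℚ ℝ) (1 / 4 : ℚ) := by simp
    rw [this, Polynomial.eval_map, Polynomial.eval₂_at_apply]
    simp
  rw [e1] at h
  have hi : Function.Injective (fun a : ℕ => 2 * a + 1) := by intro a b; simp
  have hsin : ∀ n : ℕ, Real.sin (2 * Real.pi * n * (1 / 4)) = Real.sin (n * (Real.pi / 2)) := by
    intro n; congr 1; ring
  rw [← hi.hasSum_iff] at h
  · have e2 : betaVal (2 * k + 1) = ∑' a, ((fun n : ℕ => 1 / (n : ℝ) ^ (2 * k + 1) *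
        Real.sin (2 * Real.pi * n * (1 / 4))) ∘ fun a : ℕ => 2 * a + 1) a := by
      unfold betaVal
      congr 1; ext a
      simp only [Function.comp, hsin]
      have : ((2 * a + 1 : ℕ) : ℝ) * (Real.pi / 2) = Real.pi / 2 + a * Real.pi := by push_cast; ring
      rw [this, Real.sin_add_nat_mul_pi, Real.sin_pi_div_two]
      push_cast; ring
    rw [e2, h.tsum_eq]
    set r := (Polynomial.bernoulli (2 * k + 1)).eval (1 / 4 : ℚ)
    have : ((-1) ^ (k + 1) * (2 * Real.pi) ^ (2 * k + 1) / 2 / ((2 * k + 1).factorial : ℝ) * (r : ℝ))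
      = (((-1) ^ (k + 1) * 2 ^ (2 * k + 1) / 2 / (2 * k + 1).factorial * r : ℚ) : ℝ) * Real.pi ^ (2 * k + 1) := by
      push_cast; ring
    rw [this]
    exact mul_mem (rat_mem _) (pow_mem pi_mem _)
  · intro n hn
    have : Even n := by
      rw [← Nat.not_odd_iff_even]
      rintro ⟨m, rfl⟩
      exact hn ⟨m, rfl⟩
    obtain ⟨m, rfl⟩ := this
    rw [hsin]
    have : ((m + m : ℕ) : ℝ) * (Real.pi / 2) = m * Real.pi := by push_cast; ring
    rw [this, Real.sin_nat_mul_pi, mul_zero]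

lemma eps_InA_odd (k : ℕ) (hk : 1 ≤ k) : InA (fun a => (-1) ^ a / hf a ^ (2 * k + 1)) :=
  ⟨_, mul_mem (rat_mem _) (beta_odd_mem k hk), hasSum_eps (2 * k + 1) (by omega)⟩

lemma main_gen (u v : ℕ → ℝ) (x y : ℕ → ℕ → ℝ) (hx : Good x) (hy : Good y) (q k : ℕ) (hq : 2 ≤ q)
    (hF : ∀ n a b, nn n ^ 2 / nn n ^ q * (x n a * y n b) =
      u a * v b * (nn n ^ 2 / nn n ^ (2 * k) / ((hf a ^ 2 - nn n ^ 2) * (hf b ^ 2 - nn n ^ 2))))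
    (hu : ∀ j, InA (fun a => u a / hf a ^ (2 * (j + 1)))) (hv : ∀ j, InA (fun a => v a / hf a ^ (2 * (j + 1))))
    (huv : InA (fun a => u a * v a / hf a ^ (2 * k))) :
    ∑' n, nn n ^ 2 / nn n ^ q * ((∑' a, x n a) * ∑' b, y n b) ∈ AA := by
  obtain ⟨C, hC, hx⟩ := hx
  obtain ⟨D, hD, hy⟩ := hy
  have hc : ∀ n, 0 ≤ nn n ^ 2 / nn n ^ q := fun n => by have := nn_pos n; positivity
  have hc1 : ∀ n, nn n ^ 2 / nn n ^ q ≤ 1 := fun n => by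
    have := nn_pos n
    rw [div_le_one (by positivity)]
    exact pow_le_pow_right₀ (one_le_nn n) hq
  let F : ℕ → ℕ × ℕ → ℝ := fun n p => nn n ^ 2 / nn n ^ q * (x n p.1 * y n p.2)
  have hsum : Summable (Function.uncurry F) := by
    apply Summable.of_norm
    rw [summable_prod_of_nonneg (fun _ => norm_nonneg _)]
    have hval : ∀ n p, ‖Function.uncurry F (n, p)‖ = nn n ^ 2 / nn n ^ q * (|x n p.1| * |y n p.2|) := by
      intro n p
      simp only [Function.uncurry, F, Real.norm_eq_abs, abs_mul, abs_of_nonneg (hc n)]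
    have hnx : ∀ n, Summable fun a => ‖|x n a|‖ := fun n => by simpa using (hx n).1
    have hny : ∀ n, Summable fun a => ‖|y n a|‖ := fun n => by simpa using (hy n).1
    constructor
    · intro n
      simp only [hval]
      exact ((Summable.mul_norm (hnx n) (hny n)).of_norm).mul_left _
    · simp only [hval, tsum_mul_left]
      have h0 : Summable (fun n : ℕ => 1 / |(n : ℝ) + 1| ^ (3 / 2 : ℝ)) :=
        (Real.summable_one_div_nat_add_rpow 1 _).2 (by norm_num)
      refine Summable.of_nonneg_of_le (fun n => mul_nonneg (hc n) (tsum_nonneg fun p => by positivity)) ?_ (h0.mul_left (C * D))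
      intro n
      rw [← tsum_mul_tsum_of_summable_norm (hnx n) (hny n)]
      have p0 := nn_pos n
      have e : 1 / |(n : ℝ) + 1| ^ (3 / 2 : ℝ) = nn n ^ (-(3 / 4) : ℝ) * nn n ^ (-(3 / 4) : ℝ) := by
        rw [← Real.rpow_add p0]
        have : (n : ℝ) + 1 = nn n := rfl
        rw [this, abs_of_pos p0, one_div, ← Real.rpow_neg p0.le]
        norm_num
      have t1 : 0 ≤ ∑' a, |x n a| := tsum_nonneg fun _ => abs_nonneg _
      have t2 : 0 ≤ ∑' a, |y n a| := tsum_nonneg fun _ => abs_nonneg _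
      calc _ ≤ 1 * ((∑' a, |x n a|) * ∑' a, |y n a|) := by
            have := hc1 n; gcongr
        _ ≤ 1 * ((C * nn n ^ (-(3 / 4) : ℝ)) * (D * nn n ^ (-(3 / 4) : ℝ))) := by
            have := (hx n).2; have := (hy n).2; gcongr
        _ = _ := by rw [e]; ring
  have e1 : ∀ n, nn n ^ 2 / nn n ^ q * ((∑' a, x n a) * ∑' b, y n b) = ∑' p, F n p := by
    intro n
    rw [tsum_mul_tsum_of_summable_norm (by simpa using (hx n).1) (by simpa using (hy n).1), ← tsum_mul_left]
  simp only [e1]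
  rw [← hsum.tsum_comm]
  have e2 : ∀ p : ℕ × ℕ, ∑' n, F n p = u p.1 * v p.2 * TT k p.1 p.2 := by
    intro p
    simp only [F, hF]
    exact ((hasSum_T k p.1 p.2).mul_left _).tsum_eq
  simp only [e2]
  have hpi : Real.pi ^ 2 / 4 ∈ AA := by
    have := mul_mem (rat_mem (1 / 4)) (pow_mem pi_mem 2)
    convert this using 1
    push_cast; ring
  have g1 := (huv.diag).cmul hpi
  have g2 : InA (fun p : ℕ × ℕ => ∑ i ∈ Finset.range k, ∑ j ∈ Finset.range (k - 1 - i + 1),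
      zz (k - 1 - i - j) * ((u p.1 / hf p.1 ^ (2 * (i + 1))) * (v p.2 / hf p.2 ^ (2 * (j + 1))))) :=
    InA.sum _ fun i _ => InA.sum _ fun j _ => ((hu i).mul (hv j)).cmul (zz_mem _)
  refine ((g1.add g2).congr ?_).mem
  rintro ⟨a, b⟩
  unfold TT RR
  simp only [mul_add, Finset.mul_sum]
  congr 1
  · by_cases h : a = b
    · subst h; simp; ring
    · simp [h]
  · refine Finset.sum_congr rfl fun i _ => Finset.sum_congr rfl fun j _ => ?_
    ring

lemma hbar_ge (m : ℕ) : 4 / 3 ≤ oddH (2 * m + 2) 1 (-1) := by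
  induction m with
  | zero => norm_num [oddH, Finset.sum_range_succ]
  | succ m ih =>
    have : oddH (2 * (m + 1) + 2) 1 (-1) = oddH (2 * m + 2) 1 (-1) + (1 / hf (2 * m + 2) - 1 / hf (2 * m + 3)) := by
      rw [show 2 * (m + 1) + 2 = 2 * m + 2 + 1 + 1 by ring]
      unfold oddH hf
      rw [Finset.sum_range_succ, Finset.sum_range_succ]
      have e1 : (-1 : ℝ) ^ (2 * m + 2) = 1 := Even.neg_one_pow ⟨m + 1, by ring⟩
      have e2 : (-1 : ℝ) ^ (2 * m + 2 + 1) = -1 := by rw [pow_succ, e1]; ring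
      rw [e1, e2]
      push_cast
      ring
    have h1 := hf_pos (2 * m + 2)
    have h2 : 1 / hf (2 * m + 3) ≤ 1 / hf (2 * m + 2) := by
      apply one_div_le_one_div_of_le h1
      unfold hf; push_cast; linarith
    linarith

lemma hbar_ge' (n : ℕ) : 1 ≤ oddH (n + 1) 1 (-1) := by
  rcases Nat.even_or_odd' n with ⟨m, rfl | rfl⟩
  · rcases m with _ | m
    · norm_num [oddH]
    · have h := hbar_ge m
      have : oddH (2 * (m + 1) + 1) 1 (-1) = oddH (2 * m + 2) 1 (-1) + 1 / hf (2 * m + 2) := by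
        rw [show 2 * (m + 1) + 1 = 2 * m + 2 + 1 by ring]
        unfold oddH hf
        rw [Finset.sum_range_succ]
        have e1 : (-1 : ℝ) ^ (2 * m + 2) = 1 := Even.neg_one_pow ⟨m + 1, by ring⟩
        rw [e1]
        push_cast
        ring
      have := one_div_pos.2 (hf_pos (2 * m + 2))
      linarith
  · have := hbar_ge m
    rw [show 2 * m + 1 + 1 = 2 * m + 2 by ring]; linarith

lemma h_ge (n : ℕ) : 1 ≤ oddH (n + 1) 1 1 := by
  unfold oddH
  rw [Finset.sum_range_succ']
  have : 0 ≤ ∑ k ∈ Finset.range n, (1 : ℝ) ^ (k + 1) / (((k + 1 : ℕ) : ℝ) + 1 / 2) ^ 1 :=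
    Finset.sum_nonneg fun k _ => by positivity
  norm_num at this ⊢
  linarith

lemma SSum_one : SSum2 1 1 1 1 (-1) (-1) = 0 := by
  unfold SSum2
  apply tsum_eq_zero_of_not_summable
  intro h
  have h := h.abs
  have : Summable (fun n => 1 / nn n) := by
    refine Summable.of_nonneg_of_le (fun n => (one_div_pos.2 (nn_pos n)).le) ?_ h
    intro n
    have h1 := h_ge n
    have h2 := hbar_ge' n
    have h3 := nn_pos n
    rw [abs_div, abs_mul, abs_mul, abs_pow, abs_neg, abs_one, one_pow, one_mul, pow_one, abs_of_pos (by linarith),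
      abs_of_pos (by linarith : 0 < oddH (n + 1) 1 (-1)), show (n : ℝ) + 1 = nn n from rfl, abs_of_pos h3]
    have : 1 ≤ oddH (n + 1) 1 1 * oddH (n + 1) 1 (-1) := by nlinarith
    gcongr
  apply Real.not_summable_one_div_natCast
  rw [← summable_nat_add_iff 1]
  refine this.congr ?_
  intro n; simp [nn]

lemma caseA (q : ℕ) (hq : 1 ≤ q) (he : Even q) : SSum2 1 1 q 1 1 1 ∈ AA := by
  obtain ⟨m, hm⟩ := he
  obtain ⟨k, rfl⟩ : ∃ k, m = k + 1 := ⟨m - 1, by omega⟩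
  have := main_gen (fun a => 1 / hf a) (fun a => 1 / hf a) _ _ good_x good_x q k (by omega) (by
    intro n a b
    have h1 := sq_sub_ne a n
    have h2 := sq_sub_ne b n
    have h3 := hf_pos a
    have h4 := hf_pos b
    have h5 := nn_pos n
    subst hm
    field_simp
    ring)
    (fun j => (hf_InA_odd (j + 1) (by omega)).congr fun a => by rw [div_div, ← pow_succ'])
    (fun j => (hf_InA_odd (j + 1) (by omega)).congr fun a => by rw [div_div, ← pow_succ'])
    ((hf_InA_even (k + 1) (by omega)).congr fun a => by
      have h3 := hf_pos a
      field_simp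
      ring)
  unfold SSum2
  convert this using 3 with n
  rw [oddH_x, show (n : ℝ) + 1 = nn n from rfl]
  ring

lemma caseB (q : ℕ) (hq : 1 ≤ q) (he : Even q) : SSum2 1 1 q (-1) (-1) 1 ∈ AA := by
  obtain ⟨k, hm⟩ := he
  have hsq : ∀ n : ℕ, ((-1 : ℝ) ^ n) * (-1) ^ n = 1 := fun n => by rw [← pow_add, ← two_mul, pow_mul]; simp
  have gy := good_y (fun a => (-1) ^ a) (by simp)
  have := main_gen (fun a => (-1) ^ a) (fun a => (-1) ^ a) _ _ gy gy q k (by omega) (by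
    intro n a b
    have h1 := sq_sub_ne a n
    have h2 := sq_sub_ne b n
    have h5 := nn_pos n
    subst hm
    rw [two_mul]
    field_simp)
    (fun j => eps_InA_even (j + 1) (by omega))
    (fun j => eps_InA_even (j + 1) (by omega))
    ((hf_InA_even k (by omega)).congr fun a => by rw [hsq])
  unfold SSum2
  convert this using 3 with n
  rw [oddH_y, show (n : ℝ) + 1 = nn n from rfl]
  linear_combination (nn n ^ 2 / nn n ^ q * ((∑' a, (-1) ^ a / (hf a ^ 2 - nn n ^ 2)) * ∑' a, (-1) ^ a / (hf a ^ 2 - nn n ^ 2))) * hsq n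

lemma caseC (q : ℕ) (he : Odd q) : SSum2 1 1 q 1 (-1) (-1) ∈ AA := by
  obtain ⟨k, hm⟩ := he
  rcases Nat.eq_zero_or_pos k with rfl | hk
  · rw [hm, mul_zero, zero_add, SSum_one]; exact zero_mem _
  have hsq : ∀ n : ℕ, ((-1 : ℝ) ^ n) * (-1) ^ n = 1 := fun n => by rw [← pow_add, ← two_mul, pow_mul]; simp
  have gy := good_y (fun a => (-1) ^ a) (by simp)
  have := main_gen (fun a => 1 / hf a) (fun a => (-1) ^ a) _ _ good_x gy q k (by omega) (by
    intro n a b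
    have h1 := sq_sub_ne a n
    have h2 := sq_sub_ne b n
    have h3 := hf_pos a
    have h5 := nn_pos n
    subst hm
    field_simp
    ring)
    (fun j => (hf_InA_odd (j + 1) (by omega)).congr fun a => by rw [div_div, ← pow_succ'])
    (fun j => eps_InA_even (j + 1) (by omega))
    ((eps_InA_odd k (by omega)).congr fun a => by
      have h3 := hf_pos a
      field_simp
      try ring)
  unfold SSum2
  convert this using 3 with n
  rw [oddH_x, oddH_y, show (n : ℝ) + 1 = nn n from rfl]
  linear_combination (nn n ^ 2 / nn n ^ q * ((∑' a, nn n * (1 / hf a) / (hf a ^ 2 - nn n ^ 2)) * ∑' a, (-1) ^ a / (hf a ^ 2 - nn n ^ 2))) * hsq n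

lemma SSum_comm (q : ℕ) (s t r : ℝ) : SSum2 1 1 q s t r = SSum2 1 1 q t s r := by
  unfold SSum2
  congr 1; ext n; ring

theorem stmt19 (q : ℕ) (hq : 1 ≤ q) (σ1 σ2 σ3 : ℝ)
    (h1 : σ1 = 1 ∨ σ1 = -1) (h2 : σ2 = 1 ∨ σ2 = -1) (h3 : σ3 = 1 ∨ σ3 = -1)
    (hprod : σ1 * σ2 * σ3 = 1)
    (hpar : (-1 : ℝ) ^ q = σ1 * σ2) :
    SSum2 1 1 q σ1 σ2 σ3 ∈ Algebra.adjoin ℚ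
      ({Real.pi, betaVal 2}
        ∪ {x : ℝ | ∃ k : ℕ, 1 ≤ k ∧ x = zetaVal (2 * k + 1)}
        ∪ {x : ℝ | ∃ k : ℕ, 2 ≤ k ∧ x = betaVal (2 * k)}) := by
  change _ ∈ AA
  have hE : (-1 : ℝ) ^ q = 1 → Even q := fun h => by
    by_contra h'
    rw [Nat.not_even_iff_odd] at h'
    rw [h'.neg_one_pow] at h
    norm_num at h
  have hO : (-1 : ℝ) ^ q = -1 → Odd q := fun h => by
    by_contra h'
    rw [Nat.not_odd_iff_even] at h'
    rw [h'.neg_one_pow] at h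
    norm_num at h
  rcases h1 with rfl | rfl <;> rcases h2 with rfl | rfl
  · have e : σ3 = 1 := by linarith
    subst e
    exact caseA q hq (hE (by linarith))
  · have e : σ3 = -1 := by linarith
    subst e
    exact caseC q (hO (by linarith))
  · have e : σ3 = -1 := by linarith
    subst e
    rw [SSum_comm]
    exact caseC q (hO (by linarith))
  · have e : σ3 = 1 := by linarith
    subst e
    exact caseB q hq (hE (by linarith))
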